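/- Contraction of an edge commutes with the frame matroid construction: if Ω is a signed graph and e is a positive non-loop edge of Ω, then the frame matroid of the signed graph Ω/e (obtained by contracting e, keeping signs of remaining edges) equals the matroid contraction M(Ω)/e. -/

import Mathlib

open Set

/-- A signed graph: each edge has an unordered pair of endpoints, and `neg` is
the set of negative edges. -/
structure SGraph (V E : Type*) where
  ends : E → Sym2 V
  neg : Set E

namespace SGraph

variable {V E : Type*}

/-- A cycle in a signed graph: `n ≥ 1` distinct vertices and `n` distinct edges
arranged cyclically. -/
structure Cyc (G : SGraph V E) where
  n : ℕ
  hn : 0 < n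
  vtx : ZMod n → V
  edge : ZMod n → E
  vtx_inj : Function.Injective vtx
  edge_inj : Function.Injective edge
  incid : ∀ i, G.ends (edge i) = s(vtx i, vtx (i + 1))

def Cyc.edges {G : SGraph V E} (C : Cyc G) : Set E := Set.range C.edge

def Cyc.vertices {G : SGraph V E} (C : Cyc G) : Set V := Set.range C.vtx

/-- A cycle is positive with respect to a set `N` of negative edges if it
contains an even number of edges from `N`. -/
def Cyc.PositiveIn {G : SGraph V E} (C : Cyc G) (N : Set E) : Prop :=
  Even (C.edges ∩ N).ncard

def Cyc.Positive {G : SGraph V E} (C : Cyc G) : Prop := C.PositiveIn G.neg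

def Cyc.Negative {G : SGraph V E} (C : Cyc G) : Prop := ¬ C.Positive

/-- A path joining the vertex set `S` to the vertex set `T`, internally
disjoint from `S ∪ T`. -/
structure ConnPath (G : SGraph V E) (S T : Set V) where
  n : ℕ
  vtx : Fin (n + 1) → V
  edge : Fin n → E
  vtx_inj : Function.Injective vtx
  edge_inj : Function.Injective edge
  incid : ∀ i : Fin n, G.ends (edge i) = s(vtx i.castSucc, vtx i.succ)
  first_mem : vtx 0 ∈ S
  last_mem : vtx (Fin.last n) ∈ T
  internal : ∀ i : Fin (n + 1), i ≠ 0 → i ≠ Fin.last n → vtx i ∉ S ∪ T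

def ConnPath.edges {G : SGraph V E} {S T : Set V} (P : ConnPath G S T) : Set E :=
  Set.range P.edge

/-- The circuits of the frame matroid of a signed graph: positive cycles, pairs
of negative cycles meeting in exactly one vertex, and pairs of vertex-disjoint
negative cycles together with a minimal connecting path. -/
inductive FrameCircuit (G : SGraph V E) : Set E → Prop
  | pos (C : Cyc G) (h : C.Positive) : FrameCircuit G C.edges
  | tight (C₁ C₂ : Cyc G) (h₁ : C₁.Negative) (h₂ : C₂.Negative)
      (hne : C₁.edges ≠ C₂.edges) (v : V)
      (hmeet : C₁.vertices ∩ C₂.vertices = {v}) :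
      FrameCircuit G (C₁.edges ∪ C₂.edges)
  | loose (C₁ C₂ : Cyc G) (h₁ : C₁.Negative) (h₂ : C₂.Negative)
      (hV : Disjoint C₁.vertices C₂.vertices)
      (P : ConnPath G C₁.vertices C₂.vertices) :
      FrameCircuit G (C₁.edges ∪ C₂.edges ∪ P.edges)

end SGraph

/-- `C` is a circuit of the matroid `M`: a minimal dependent set. -/
def Matroid.IsCircuit' {E : Type*} (M : Matroid E) (C : Set E) : Prop :=
  C ⊆ M.E ∧ ¬ M.Indep C ∧ ∀ D ⊂ C, M.Indep D

/-- `M` is the frame matroid of the signed graph `G`: its ground set is all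
edges and its circuits are exactly the frame circuits of `G`. -/
def SGraph.IsFrameMatroid {V E : Type*} (G : SGraph V E) (M : Matroid E) : Prop :=
  M.E = Set.univ ∧ ∀ C : Set E, M.IsCircuit' C ↔ G.FrameCircuit C

/-- The signed graph obtained by contracting the non-loop edge `e` with
endpoints `u ≠ v`: the vertex `v` is identified with `u`, the edge `e` is
deleted, and all remaining edges keep their signs. -/
def SGraph.contractEdge {V E : Type*} [DecidableEq V] (G : SGraph V E)
    (e : E) (u v : V) : SGraph V {f : E // f ≠ e} where
  ends := fun f => (G.ends f.1).map (fun x => if x = v then u else x)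
  neg := {f | (f : E) ∈ G.neg}

/-- Deletion of a set of elements from a matroid. -/
def Matroid.del {α : Type*} (M : Matroid α) (D : Set α) : Matroid α :=
  M.restrict (M.E \ D)

/-- Contraction of a set of elements in a matroid, via duality. -/
def Matroid.con {α : Type*} (M : Matroid α) (C : Set α) : Matroid α :=
  (M✶.del C)✶


namespace SGraph

variable {V E : Type*}

open Classical in
/-- The sign of an edge, as a rational number. -/
noncomputable def sg (G : SGraph V E) (f : E) : ℚ := if f ∈ G.neg then -1 else 1

lemma sg_mul_self (G : SGraph V E) (f : E) : G.sg f * G.sg f = 1 := by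
  unfold sg; split_ifs <;> norm_num

lemma sg_cases (G : SGraph V E) (f : E) : G.sg f = 1 ∨ G.sg f = -1 := by
  unfold sg; split_ifs <;> simp

lemma sg_ne_zero (G : SGraph V E) (f : E) : G.sg f ≠ 0 := by
  rcases G.sg_cases f with h | h <;> rw [h] <;> norm_num

/-- Product of the signs of the first `n` edges. -/
noncomputable def sp (G : SGraph V E) (e : ℕ → E) (n : ℕ) : ℚ := ∏ i ∈ Finset.range n, G.sg (e i)

lemma sp_succ (G : SGraph V E) (e : ℕ → E) (n : ℕ) : G.sp e (n + 1) = G.sp e n * G.sg (e n) :=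
  Finset.prod_range_succ _ _

lemma sp_succ' (G : SGraph V E) (e : ℕ → E) (n : ℕ) :
    G.sp e (n + 1) = G.sp (fun i => e (i + 1)) n * G.sg (e 0) :=
  Finset.prod_range_succ' _ _

lemma sp_add (G : SGraph V E) (e : ℕ → E) (m n : ℕ) :
    G.sp e (m + n) = G.sp e m * G.sp (fun i => e (m + i)) n :=
  Finset.prod_range_add _ _ _

lemma sp_rev (G : SGraph V E) (e : ℕ → E) (n : ℕ) :
    G.sp (fun i => e (n - 1 - i)) n = G.sp e n :=
  Finset.prod_range_reflect (fun i => G.sg (e i)) n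

lemma sp_congr (G : SGraph V E) {e eb : ℕ → E} {n : ℕ} (h : ∀ i < n, e i = eb i) :
    G.sp e n = G.sp eb n :=
  Finset.prod_congr rfl (fun i hi => by rw [h i (Finset.mem_range.1 hi)])

lemma sp_cases (G : SGraph V E) (e : ℕ → E) (n : ℕ) : G.sp e n = 1 ∨ G.sp e n = -1 := by
  induction n with
  | zero => left; simp [sp]
  | succ n ih =>
    rw [sp_succ]
    rcases ih with h | h <;> rcases G.sg_cases (e n) with h' | h' <;> rw [h, h'] <;> norm_num

lemma even_iff_sp (G : SGraph V E) (e : ℕ → E) (n : ℕ) (he : InjOn e (Iio n)) :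
    Even ((e '' Iio n) ∩ G.neg).ncard ↔ G.sp e n = 1 := by
  classical
  have h1 : ((e '' Iio n) ∩ G.neg) =
      ((((Finset.range n).filter (fun i => e i ∈ G.neg)).image e : Finset E) : Set E) := by
    ext f; simp; constructor
    · rintro ⟨⟨i, hi, rfl⟩, h⟩; exact ⟨i, ⟨hi, h⟩, rfl⟩
    · rintro ⟨i, ⟨hi, h⟩, rfl⟩; exact ⟨⟨i, hi, rfl⟩, h⟩
  rw [h1, Set.ncard_coe_finset, Finset.card_image_of_injOn]
  · have : G.sp e n = (-1) ^ ((Finset.range n).filter (fun i => e i ∈ G.neg)).card := by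
      unfold sp sg
      rw [Finset.prod_ite]; simp
    rw [this, neg_one_pow_eq_one_iff_even (by norm_num)]
  · intro a ha b hb h
    simp at ha hb
    exact he ha.1 hb.1 h

/-- Path of length `n` indexed by naturals. -/
structure NPath (G : SGraph V E) (n : ℕ) (x : ℕ → V) (e : ℕ → E) : Prop where
  inj : ∀ i j, i ≤ n → j ≤ n → x i = x j → i = j
  inc : ∀ i, i < n → G.ends (e i) = s(x i, x (i + 1))

/-- Cycle of length `n` indexed by naturals. -/
structure NCyc (G : SGraph V E) (n : ℕ) (x : ℕ → V) (e : ℕ → E) : Prop where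
  pos : 0 < n
  inj : ∀ i j, i < n → j < n → x i = x j → i = j
  einj : ∀ i j, i < n → j < n → e i = e j → i = j
  inc : ∀ i, i < n → G.ends (e i) = s(x i, x (i + 1))
  close : x n = x 0

lemma NPath.einj {G : SGraph V E} {n x e} (h : NPath G n x e) (i j : ℕ) (hi : i < n) (hj : j < n)
    (hij : e i = e j) : i = j := by
  have h1 := h.inc i hi
  rw [hij, h.inc j hj, Sym2.eq_iff] at h1
  rcases h1 with h1 | h1
  · exact (h.inj _ _ hj.le hi.le h1.1).symm
  · have a := h.inj _ _ hj.le (by omega) h1.1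
    have b := h.inj _ _ (by omega) hi.le h1.2
    omega

lemma NPath.rev {G : SGraph V E} {n x e} (h : NPath G n x e) :
    NPath G n (fun i => x (n - i)) (fun i => e (n - 1 - i)) where
  inj i j hi hj hij := by
    have := h.inj _ _ (by omega) (by omega) hij
    omega
  inc i hi := by
    have h1 : n - 1 - i + 1 = n - i := by omega
    have h2 : n - 1 - i = n - (i + 1) := by omega
    rw [h.inc _ (by omega), Sym2.eq_swap, h1, h2]

lemma rev_image {α : Type*} (e : ℕ → α) (n : ℕ) :
    (fun i => e (n - 1 - i)) '' Iio n = e '' Iio n := by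
  ext f; constructor
  · rintro ⟨i, hi, rfl⟩
    simp at hi
    exact ⟨n - 1 - i, by simp; omega, rfl⟩
  · rintro ⟨i, hi, rfl⟩
    simp at hi
    refine ⟨n - 1 - i, by simp; omega, ?_⟩
    show e _ = _
    congr 1; omega

lemma NPath.sub {G : SGraph V E} {n x e} (h : NPath G n x e) (a m : ℕ) (ham : a + m ≤ n) :
    NPath G m (fun i => x (a + i)) (fun i => e (a + i)) where
  inj i j hi hj hij := by
    have := h.inj _ _ (by omega) (by omega) hij
    omega
  inc i hi := by
    rw [h.inc _ (by omega)]; rfl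

lemma NCyc.front {G : SGraph V E} {n x e} (h : NCyc G n x e) (m : ℕ) (hm : m < n) :
    NPath G m x e where
  inj i j hi hj hij := h.inj _ _ (by omega) (by omega) hij
  inc i hi := h.inc _ (by omega)

lemma NCyc.tail {G : SGraph V E} {n x e} (h : NCyc G n x e) (a : ℕ) (ha : 0 < a) (han : a ≤ n) :
    NPath G (n - a) (fun i => x (a + i)) (fun i => e (a + i)) where
  inj i j hi hj hij := by
    have key : ∀ k, k ≤ n → ∃ k', k' < n ∧ x k = x k' ∧ (k < n → k' = k) ∧ (k = n → k' = 0) := by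
      intro k hk
      rcases Nat.lt_or_ge k n with h1 | h1
      · exact ⟨k, h1, rfl, fun _ => rfl, by omega⟩
      · have : k = n := by omega
        subst this
        exact ⟨0, h.pos, h.close, by omega, fun _ => rfl⟩
    obtain ⟨i', a1, a2, a3, a4⟩ := key (a + i) (by omega)
    obtain ⟨j', b1, b2, b3, b4⟩ := key (a + j) (by omega)
    have := h.inj i' j' a1 b1 (by rw [← a2, ← b2]; exact hij)
    rcases Nat.lt_or_ge (a + i) n with h1 | h1 <;> rcases Nat.lt_or_ge (a + j) n with h2 | h2
    · have := a3 h1; have := b3 h2; omega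
    · have := a3 h1; have := b4 (by omega); omega
    · have := a4 (by omega); have := b3 h2; omega
    · omega
  inc i hi := by
    rw [h.inc _ (by omega)]; rfl

/-- `w` represents the signed graph `G` linearly. -/
def IsRep (G : SGraph V E) (w : E → V →₀ ℚ) : Prop :=
  ∀ f x y, G.ends f = s(x, y) →
    ∃ ε : ℚ, ε ≠ 0 ∧ w f = ε • (Finsupp.single x 1 - Finsupp.single y (G.sg f))

section Lin

variable {G : SGraph V E} {w : E → V →₀ ℚ}

lemma IsRep.mem_iff (hw : G.IsRep w) {f : E} {x y : V} (hf : G.ends f = s(x, y))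
    (S : Submodule ℚ (V →₀ ℚ)) :
    w f ∈ S ↔ Finsupp.single x (1 : ℚ) - G.sg f • Finsupp.single y 1 ∈ S := by
  obtain ⟨ε, hε, h⟩ := hw f x y hf
  rw [h, S.smul_mem_iff hε]; simp

lemma IsRep.step (hw : G.IsRep w) {f : E} {x y : V} (hf : G.ends f = s(x, y))
    (S : Submodule ℚ (V →₀ ℚ)) (hS : w f ∈ S) :
    Finsupp.single x (1 : ℚ) ∈ S ↔ Finsupp.single y (1 : ℚ) ∈ S := by
  rw [hw.mem_iff hf] at hS
  constructor
  · intro h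
    have := S.sub_mem h hS
    rw [sub_sub_cancel] at this
    exact (S.smul_mem_iff (G.sg_ne_zero f)).1 this
  · intro h
    have := S.add_mem hS (S.smul_mem (G.sg f) h)
    rwa [sub_add_cancel] at this

lemma IsRep.mem_of_ends (hw : G.IsRep w) {f : E} {x y : V} (hf : G.ends f = s(x, y))
    (S : Submodule ℚ (V →₀ ℚ)) (hx : Finsupp.single x (1 : ℚ) ∈ S)
    (hy : Finsupp.single y (1 : ℚ) ∈ S) : w f ∈ S := by
  rw [hw.mem_iff hf]
  exact S.sub_mem hx (S.smul_mem _ hy)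

lemma IsRep.apply_eq_zero (hw : G.IsRep w) {f : E} {x y z : V} (hf : G.ends f = s(x, y))
    (hx : z ≠ x) (hy : z ≠ y) : w f z = 0 := by
  obtain ⟨ε, hε, h⟩ := hw f x y hf
  rw [h]
  simp [hx.symm, hy.symm]

lemma IsRep.apply_ne_zero (hw : G.IsRep w) {f : E} {x y : V} (hf : G.ends f = s(x, y))
    (hxy : x ≠ y) : w f y ≠ 0 := by
  obtain ⟨ε, hε, h⟩ := hw f x y hf
  rw [h]
  simp [hxy, hε, G.sg_ne_zero]

lemma walk_span (hw : G.IsRep w) (S : Submodule ℚ (V →₀ ℚ)) (x : ℕ → V) (e : ℕ → E) (n : ℕ)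
    (h : ∀ i < n, G.ends (e i) = s(x i, x (i + 1))) (hS : ∀ i < n, w (e i) ∈ S) :
    Finsupp.single (x 0) (1 : ℚ) - G.sp e n • Finsupp.single (x n) 1 ∈ S := by
  induction n with
  | zero => simp [sp]
  | succ n ih =>
    have h1 := ih (fun i hi => h i (by omega)) (fun i hi => hS i (by omega))
    have h2 := (hw.mem_iff (h n (by omega)) S).1 (hS n (by omega))
    have := S.add_mem h1 (S.smul_mem (G.sp e n) h2)
    convert this using 1
    rw [sp_succ, smul_sub, mul_smul]
    abel

lemma walk_all (hw : G.IsRep w) (S : Submodule ℚ (V →₀ ℚ)) (x : ℕ → V) (e : ℕ → E) (n : ℕ)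
    (h : ∀ i < n, G.ends (e i) = s(x i, x (i + 1))) (hS : ∀ i < n, w (e i) ∈ S) :
    Finsupp.single (x 0) (1 : ℚ) ∈ S ↔ Finsupp.single (x n) (1 : ℚ) ∈ S := by
  induction n with
  | zero => rfl
  | succ n ih =>
    rw [ih (fun i hi => h i (by omega)) (fun i hi => hS i (by omega)),
      hw.step (h n (by omega)) S (hS n (by omega))]

lemma NCyc.neg_span (hw : G.IsRep w) {n x e} (h : NCyc G n x e) (hneg : G.sp e n ≠ 1)
    (S : Submodule ℚ (V →₀ ℚ)) (hS : ∀ i < n, w (e i) ∈ S) :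
    Finsupp.single (x 0) (1 : ℚ) ∈ S := by
  have h1 := walk_span hw S x e n h.inc hS
  rw [(G.sp_cases e n).resolve_left hneg, h.close] at h1
  have : (2 : ℚ) • Finsupp.single (x 0) (1 : ℚ) ∈ S := by
    convert h1 using 1
    rw [two_smul]; simp
  exact (S.smul_mem_iff (by norm_num)).1 this

/-- Extending an independent set along a path. -/
lemma ext_path (hw : G.IsRep w) {S : Set E} (hS : LinearIndepOn ℚ w S) (m : ℕ) (x : ℕ → V)
    (e : ℕ → E) (h : NPath G m x e) (h0 : ∀ f ∈ S, ∀ j, 1 ≤ j → j ≤ m → w f (x j) = 0) :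
    LinearIndepOn ℚ w (S ∪ e '' Iio m) := by
  induction m with
  | zero => simpa using hS
  | succ m ih =>
    have h' : NPath G m x e :=
      ⟨fun i j hi hj => h.inj i j (by omega) (by omega), fun i hi => h.inc i (by omega)⟩
    have h1 := ih h' (fun f hf j hj hjm => h0 f hf j hj (by omega))
    have : S ∪ e '' Iio (m + 1) = insert (e m) (S ∪ e '' Iio m) := by
      ext f; simp only [mem_union, mem_image, mem_Iio, mem_insert_iff]
      constructor
      · rintro (hf | ⟨i, hi, rfl⟩)
        · tauto
        · rcases Nat.lt_succ_iff_lt_or_eq.1 hi with hi | rfl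
          · right; right; exact ⟨i, hi, rfl⟩
          · left; rfl
      · rintro (rfl | hf | ⟨i, hi, rfl⟩)
        · right; exact ⟨m, by omega, rfl⟩
        · tauto
        · right; exact ⟨i, by omega, rfl⟩
    rw [this]
    refine h1.insert ?_
    intro hmem
    have hker : Submodule.span ℚ (w '' (S ∪ e '' Iio m)) ≤
        LinearMap.ker (Finsupp.lapply (x (m + 1)) : (V →₀ ℚ) →ₗ[ℚ] ℚ) := by
      rw [Submodule.span_le]
      rintro _ ⟨f, hf | ⟨i, hi, rfl⟩, rfl⟩
      · simpa using h0 f hf (m + 1) (by omega) le_rfl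
      · simp only [mem_Iio] at hi
        have : w (e i) (x (m + 1)) = 0 := by
          refine hw.apply_eq_zero (h.inc i (by omega)) ?_ ?_
          · intro hh; have := h.inj _ _ le_rfl (by omega) hh; omega
          · intro hh; have := h.inj _ _ le_rfl (by omega) hh; omega
        simpa using this
    have := hker hmem
    have h2 : w (e m) (x (m + 1)) ≠ 0 := by
      refine hw.apply_ne_zero (h.inc m (by omega)) ?_
      intro hh; have := h.inj _ _ (by omega) le_rfl hh; omega
    exact h2 (by simpa using this)

/-- A functional killing all edges of a path. -/
lemma NPath.functional (hw : G.IsRep w) {m x e} (h : NPath G m x e) :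
    ∃ τ : V → ℚ, (∀ z, (∀ i ≤ m, z ≠ x i) → τ z = 0) ∧ (∀ i ≤ m, τ (x i) = G.sp e i) ∧
      ∀ i < m, Finsupp.linearCombination ℚ τ (w (e i)) = 0 := by
  classical
  let τ : V → ℚ := fun z => if hz : ∃ i, i ≤ m ∧ x i = z then G.sp e hz.choose else 0
  have h1 : ∀ i ≤ m, τ (x i) = G.sp e i := by
    intro i hi
    have hz : ∃ j, j ≤ m ∧ x j = x i := ⟨i, hi, rfl⟩
    have : hz.choose = i := h.inj _ _ hz.choose_spec.1 hi hz.choose_spec.2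
    simp only [τ]
    rw [dif_pos hz, this]
  refine ⟨τ, ?_, h1, ?_⟩
  · intro z hz
    simp only [τ]
    rw [dif_neg]
    rintro ⟨i, hi, rfl⟩
    exact hz i hi rfl
  · intro i hi
    obtain ⟨ε, hε, he⟩ := hw _ _ _ (h.inc i hi)
    rw [he]
    simp only [map_smul, map_sub, Finsupp.linearCombination_single]
    rw [h1 i hi.le, h1 (i + 1) hi, sp_succ]
    have := G.sg_mul_self (e i)
    simp only [smul_eq_mul]
    linear_combination (-ε * G.sp e i) * this

/-- Extending an independent set by a disjoint negative cycle. -/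
lemma ext_neg (hw : G.IsRep w) {S : Set E} (hS : LinearIndepOn ℚ w S) {n : ℕ} {x : ℕ → V}
    {e : ℕ → E} (h : NCyc G n x e) (hneg : G.sp e n ≠ 1)
    (h0 : ∀ f ∈ S, ∀ j, j < n → w f (x j) = 0) :
    LinearIndepOn ℚ w (S ∪ e '' Iio n) := by
  obtain ⟨m, rfl⟩ : ∃ m, n = m + 1 := ⟨n - 1, by have := h.pos; omega⟩
  have hp : NPath G m (fun i => x (1 + i)) (fun i => e (1 + i)) := h.tail 1 (by omega) (by omega)
  have hx : ∀ j ≤ m, ∃ k < m + 1, x (1 + j) = x k := by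
    intro j hj
    rcases Nat.lt_or_ge j m with h1 | h1
    · exact ⟨1 + j, by omega, rfl⟩
    · have : j = m := by omega
      subst this
      exact ⟨0, by omega, by rw [← h.close, add_comm]⟩
  have h1 := ext_path hw hS m _ _ hp (by
    intro f hf j hj hjm
    obtain ⟨k, hk, hk'⟩ := hx j hjm
    simp only [hk']
    exact h0 f hf k hk)
  obtain ⟨τ, t1, t2, t3⟩ := hp.functional hw
  have : S ∪ e '' Iio (m + 1) = insert (e 0) (S ∪ (fun i => e (1 + i)) '' Iio m) := by
    ext f; simp only [mem_union, mem_image, mem_Iio, mem_insert_iff]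
    constructor
    · rintro (hf | ⟨i, hi, rfl⟩)
      · tauto
      · rcases Nat.eq_zero_or_pos i with rfl | hi0
        · left; rfl
        · right; right; exact ⟨i - 1, by omega, by congr 1; omega⟩
    · rintro (rfl | hf | ⟨i, hi, rfl⟩)
      · right; exact ⟨0, by omega, rfl⟩
      · tauto
      · right; exact ⟨1 + i, by omega, rfl⟩
  rw [this]
  refine h1.insert ?_
  intro hmem
  have hker : Submodule.span ℚ (w '' (S ∪ (fun i => e (1 + i)) '' Iio m)) ≤
      LinearMap.ker (Finsupp.linearCombination ℚ τ) := by
    rw [Submodule.span_le]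
    rintro _ ⟨f, hf | ⟨i, hi, rfl⟩, rfl⟩
    · simp only [SetLike.mem_coe, LinearMap.mem_ker, Finsupp.linearCombination_apply, Finsupp.sum]
      refine Finset.sum_eq_zero fun z _ => ?_
      by_cases hz : ∀ i ≤ m, z ≠ x (1 + i)
      · rw [t1 z hz]; simp
      · push Not at hz
        obtain ⟨i, hi, rfl⟩ := hz
        obtain ⟨k, hk, hk'⟩ := hx i hi
        rw [hk', h0 f hf k hk]; simp
    · exact t3 i hi
  have h2 := hker hmem
  obtain ⟨ε, hε, he⟩ := hw _ _ _ (h.inc 0 (by omega))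
  rw [LinearMap.mem_ker, he] at h2
  simp only [map_smul, map_sub, Finsupp.linearCombination_single] at h2
  have ta := t2 0 (by omega)
  have tb := t2 m le_rfl
  rw [add_comm 1 m, h.close] at tb
  have hs := (G.sp_cases e (m + 1)).resolve_left hneg
  rw [sp_succ'] at hs
  have e1 : (fun i => e (1 + i)) = fun i => e (i + 1) := by funext i; rw [add_comm]
  rw [show (0 : ℕ) + 1 = 1 + 0 from rfl, ta, tb, e1] at h2
  simp only [smul_eq_mul, sp, Finset.range_zero, Finset.prod_empty] at h2 hs
  have h3 := (mul_eq_zero.1 h2).resolve_left hε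
  have h4 := G.sg_mul_self (e 0)
  rw [one_mul, mul_one, sub_eq_zero] at h3
  rw [h3, h4] at hs
  norm_num at hs

/-- Extending an independent set by a cycle minus an edge. -/
lemma ext_cyc_minus (hw : G.IsRep w) {S : Set E} (hS : LinearIndepOn ℚ w S) {n : ℕ} {x : ℕ → V}
    {e : ℕ → E} (h : NCyc G n x e) {i : ℕ} (hi : i < n)
    (h0 : ∀ f ∈ S, ∀ j, 1 ≤ j → j < n → w f (x j) = 0) :
    LinearIndepOn ℚ w (S ∪ (e '' Iio n \ {e i})) := by
  have h1 := ext_path hw hS i x e (h.front i hi) (fun f hf j hj hji => h0 f hf j hj (by omega))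
  have h2 := ext_path hw h1 (n - (i + 1)) _ _ (h.tail (i + 1) (by omega) (by omega)).rev (by
    rintro f (hf | ⟨k, hk, rfl⟩) j hj hjn
    · exact h0 f hf _ (by omega) (by omega)
    · simp only [mem_Iio] at hk
      refine hw.apply_eq_zero (h.inc k (by omega)) ?_ ?_
      · intro hh
        have := h.inj _ _ (by omega) (by omega) hh
        omega
      · intro hh
        have := h.inj _ _ (by omega) (by omega) hh
        omega)
  refine h2.mono ?_
  rintro f (hf | ⟨⟨k, hk, rfl⟩, hk'⟩)
  · left; left; exact hf
  · simp only [mem_Iio] at hk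
    rcases lt_trichotomy k i with h3 | h3 | h3
    · left; right; exact ⟨k, h3, rfl⟩
    · subst h3; exact absurd rfl hk'
    · right
      rw [rev_image (fun j => e (i + 1 + j))]
      exact ⟨k - (i + 1), by simp; omega, by show e _ = _; congr 1; omega⟩

lemma not_indep_of_mem_span {C : Set E} {f : E} (hf : f ∈ C)
    (h : w f ∈ Submodule.span ℚ (w '' (C \ {f}))) : ¬ LinearIndepOn ℚ w C :=
  fun hC => hC.notMem_span hf h

lemma NCyc.pos_dep (hw : G.IsRep w) {n x e} (h : NCyc G n x e) (hpos : G.sp e n = 1) :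
    ¬ LinearIndepOn ℚ w (e '' Iio n) := by
  have hn := h.pos
  obtain ⟨m, rfl⟩ : ∃ m, n = m + 1 := ⟨n - 1, by omega⟩
  refine not_indep_of_mem_span (f := e 0) ⟨0, hn, rfl⟩ ?_
  set S := Submodule.span ℚ (w '' (e '' Iio (m + 1) \ {e 0})) with hSdef
  have h1 := walk_span hw S (fun i => x (i + 1)) (fun i => e (i + 1)) m
    (fun i hi => h.inc (i + 1) (by omega)) (by
      intro i hi
      refine Submodule.subset_span ⟨_, ⟨⟨i + 1, by simpa using hi, rfl⟩, ?_⟩, rfl⟩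
      intro hh
      have := h.einj _ _ (by omega) (by omega) hh
      omega)
  rw [sp_succ'] at hpos
  have hs := G.sg_mul_self (e 0)
  have h2 : G.sp (fun i => e (i + 1)) m = G.sg (e 0) := by
    have := congrArg (· * G.sg (e 0)) hpos
    simp only [mul_assoc, hs, one_mul, mul_one] at this
    exact this
  rw [h2] at h1
  simp only [h.close] at h1
  rw [hw.mem_iff (x := x 1) (y := x 0) (by rw [h.inc 0 hn, Sym2.eq_swap])]
  exact h1

end Lin

section Conv

variable {G : SGraph V E}

lemma Cyc.toN (C : Cyc G) {z : V} (hz : z ∈ C.vertices) :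
    ∃ x e, NCyc G C.n x e ∧ x 0 = z ∧ e '' Iio C.n = C.edges ∧ x '' Iio C.n = C.vertices ∧
      (C.Positive ↔ G.sp e C.n = 1) := by
  obtain ⟨a, rfl⟩ := hz
  have : NeZero C.n := ⟨C.hn.ne'⟩
  have hinj : ∀ i j : ℕ, i < C.n → j < C.n → a + (i : ZMod C.n) = a + j → i = j := by
    intro i j hi hj h
    have h := add_left_cancel h
    rw [ZMod.natCast_eq_natCast_iff', Nat.mod_eq_of_lt hi, Nat.mod_eq_of_lt hj] at h
    exact h
  have hsurj : ∀ j : ZMod C.n, ∃ i : ℕ, i < C.n ∧ a + (i : ZMod C.n) = j := by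
    intro j
    exact ⟨(j - a).val, ZMod.val_lt _, by simp⟩
  have hc : NCyc G C.n (fun i => C.vtx (a + i)) (fun i => C.edge (a + i)) :=
    { pos := C.hn
      inj := fun i j hi hj h => hinj i j hi hj (C.vtx_inj h)
      einj := fun i j hi hj h => hinj i j hi hj (C.edge_inj h)
      inc := fun i hi => by rw [C.incid]; push_cast; rw [add_assoc]
      close := by simp }
  have he : (fun i : ℕ => C.edge (a + i)) '' Iio C.n = C.edges := by
    ext f; constructor
    · rintro ⟨i, hi, rfl⟩; exact ⟨_, rfl⟩
    · rintro ⟨j, rfl⟩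
      obtain ⟨i, hi, rfl⟩ := hsurj j
      exact ⟨i, hi, rfl⟩
  refine ⟨_, _, hc, by simp, he, ?_, ?_⟩
  · ext f; constructor
    · rintro ⟨i, hi, rfl⟩; exact ⟨_, rfl⟩
    · rintro ⟨j, rfl⟩
      obtain ⟨i, hi, rfl⟩ := hsurj j
      exact ⟨i, hi, rfl⟩
  · rw [← G.even_iff_sp _ _ (fun i hi j hj h => hc.einj i j hi hj h), he]; rfl

lemma NCyc.toC {n x e} (h : NCyc G n x e) :
    ∃ C : Cyc G, C.edges = e '' Iio n ∧ C.vertices = x '' Iio n ∧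
      (C.Positive ↔ G.sp e n = 1) := by
  have : NeZero n := ⟨h.pos.ne'⟩
  let C : Cyc G :=
    { n := n
      hn := h.pos
      vtx := fun i => x i.val
      edge := fun i => e i.val
      vtx_inj := fun i j hij => ZMod.val_injective n (h.inj _ _ (ZMod.val_lt _) (ZMod.val_lt _) hij)
      edge_inj := fun i j hij =>
        ZMod.val_injective n (h.einj _ _ (ZMod.val_lt _) (ZMod.val_lt _) hij)
      incid := fun i => by
        rw [h.inc _ (ZMod.val_lt _)]
        have h1 : (i + 1) = ((i.val + 1 : ℕ) : ZMod n) := by simp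
        rw [h1, ZMod.val_natCast]
        rcases Nat.lt_or_ge (i.val + 1) n with h2 | h2
        · rw [Nat.mod_eq_of_lt h2]
        · have h3 : i.val + 1 = n := by have := ZMod.val_lt i; omega
          rw [h3, Nat.mod_self, h.close] }
  have he : C.edges = e '' Iio n := by
    ext f; constructor
    · rintro ⟨i, rfl⟩; exact ⟨i.val, ZMod.val_lt _, rfl⟩
    · rintro ⟨i, hi, rfl⟩
      refine ⟨(i : ZMod n), ?_⟩
      show e _ = _
      rw [ZMod.val_natCast, Nat.mod_eq_of_lt hi]
  refine ⟨C, he, ?_, ?_⟩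
  · ext f; constructor
    · rintro ⟨i, rfl⟩; exact ⟨i.val, ZMod.val_lt _, rfl⟩
    · rintro ⟨i, hi, rfl⟩
      refine ⟨(i : ZMod n), ?_⟩
      show x _ = _
      rw [ZMod.val_natCast, Nat.mod_eq_of_lt hi]
  · rw [← G.even_iff_sp _ _ (fun i hi j hj h' => h.einj i j hi hj h'), ← he]; rfl

lemma ConnPath.toN {S T : Set V} (P : ConnPath G S T) (d : E) :
    ∃ y g, NPath G P.n y g ∧ y 0 ∈ S ∧ y P.n ∈ T ∧
      (∀ i, 0 < i → i < P.n → y i ∉ S ∪ T) ∧ g '' Iio P.n = P.edges := by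
  let y : ℕ → V := fun i => P.vtx ⟨min i P.n, by omega⟩
  let g : ℕ → E := fun i => if h : i < P.n then P.edge ⟨i, h⟩ else d
  have hy : ∀ i (hi : i < P.n + 1), y i = P.vtx ⟨i, hi⟩ := by
    intro i hi
    simp only [y]
    congr 2; omega
  have hg : ∀ i (hi : i < P.n), g i = P.edge ⟨i, hi⟩ := by
    intro i hi
    simp only [g]; rw [dif_pos hi]
  refine ⟨y, g, ⟨?_, ?_⟩, ?_, ?_, ?_, ?_⟩
  · intro i j hi hj h
    rw [hy i (by omega), hy j (by omega)] at h
    have := P.vtx_inj h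
    simpa using this
  · intro i hi
    rw [hg i hi, P.incid, hy i (by omega), hy (i + 1) (by omega)]
    rfl
  · rw [hy 0 (by omega)]; exact P.first_mem
  · rw [hy P.n (by omega)]; exact P.last_mem
  · intro i hi hin
    rw [hy i (by omega)]
    refine P.internal _ ?_ ?_
    · intro h; have := congrArg Fin.val h; simp at this; omega
    · intro h; have := congrArg Fin.val h; simp at this; omega
  · ext f; constructor
    · rintro ⟨i, hi, rfl⟩
      exact ⟨⟨i, hi⟩, (hg i hi).symm⟩
    · rintro ⟨i, rfl⟩
      exact ⟨i, i.2, hg i i.2⟩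

lemma NPath.toP {n y g} (h : NPath G n y g) {S T : Set V} (h0 : y 0 ∈ S) (hn : y n ∈ T)
    (hi : ∀ i, 0 < i → i < n → y i ∉ S ∪ T) :
    ∃ P : ConnPath G S T, P.edges = g '' Iio n := by
  refine ⟨{ n := n, vtx := fun i => y i, edge := fun i => g i, vtx_inj := ?_, edge_inj := ?_,
            incid := ?_, first_mem := ?_, last_mem := ?_, internal := ?_ }, ?_⟩
  · intro i j hij
    exact Fin.ext (h.inj _ _ (by omega) (by omega) hij)
  · intro i j hij
    exact Fin.ext (h.einj _ _ i.2 j.2 hij)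
  · intro i
    exact h.inc i i.2
  · exact h0
  · exact hn
  · intro i h1 h2
    refine hi i ?_ ?_
    · rcases Nat.eq_zero_or_pos i.val with h3 | h3
      · exact absurd (Fin.ext h3) h1
      · exact h3
    · rcases Nat.lt_or_ge i.val n with h3 | h3
      · exact h3
      · exact absurd (Fin.ext (by simp; omega)) h2
  · ext f; constructor
    · rintro ⟨i, rfl⟩; exact ⟨i, i.2, rfl⟩
    · rintro ⟨i, hi, rfl⟩; exact ⟨⟨i, hi⟩, rfl⟩

lemma NCyc.mem {n x e} (h : NCyc G n x e) (i : ℕ) (hi : i ≤ n) : ∃ j < n, x i = x j := by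
  rcases Nat.lt_or_ge i n with h1 | h1
  · exact ⟨i, h1, rfl⟩
  · have : i = n := by omega
    subst this
    exact ⟨0, h.pos, h.close⟩

/-- Handcuffs, tight or loose. -/
structure HC (G : SGraph V E) (n : ℕ) (x : ℕ → V) (e : ℕ → E) (nb : ℕ) (xb : ℕ → V) (eb : ℕ → E)
    (k : ℕ) (y : ℕ → V) (g : ℕ → E) : Prop where
  c1 : NCyc G n x e
  c2 : NCyc G nb xb eb
  p : NPath G k y g
  neg1 : G.sp e n ≠ 1
  neg2 : G.sp eb nb ≠ 1
  y0 : y 0 = x 0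
  yk : y k = xb 0
  d1 : ∀ i j, i < n → j ≤ k → x i = y j → j = 0
  d2 : ∀ i j, i < nb → j ≤ k → xb i = y j → j = k
  d12 : ∀ i j, i < n → j < nb → x i = xb j → i = 0 ∧ j = 0 ∧ k = 0
  ed : ∀ i j, i < n → j < nb → e i ≠ eb j

lemma HC.symm {n x e nb xb eb k y g} (h : HC G n x e nb xb eb k y g) :
    HC G nb xb eb n x e k (fun i => y (k - i)) (fun i => g (k - 1 - i)) where
  c1 := h.c2
  c2 := h.c1
  p := h.p.rev
  neg1 := h.neg2
  neg2 := h.neg1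
  y0 := by simpa using h.yk
  yk := by simpa using h.y0
  d1 i j hi hj hij := by
    have := h.d2 i (k - j) hi (by omega) hij
    omega
  d2 i j hi hj hij := by
    have := h.d1 i (k - j) hi (by omega) hij
    omega
  d12 i j hi hj hij := by
    have := h.d12 j i hj hi hij.symm
    tauto
  ed i j hi hj hij := h.ed j i hj hi hij.symm

variable {w : E → V →₀ ℚ}

lemma HC.dep (hw : G.IsRep w) {n x e nb xb eb k y g} (h : HC G n x e nb xb eb k y g) :
    ¬ LinearIndepOn ℚ w (e '' Iio n ∪ eb '' Iio nb ∪ g '' Iio k) := by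
  have hn := h.c1.pos
  refine not_indep_of_mem_span (f := e 0) (Or.inl (Or.inl ⟨0, hn, rfl⟩)) ?_
  set S := Submodule.span ℚ (w '' ((e '' Iio n ∪ eb '' Iio nb ∪ g '' Iio k) \ {e 0})) with hSdef
  have s2 : ∀ i < nb, w (eb i) ∈ S := by
    intro i hi
    refine Submodule.subset_span ⟨_, ⟨Or.inl (Or.inr ⟨i, hi, rfl⟩), ?_⟩, rfl⟩
    intro hh
    exact h.ed 0 i hn hi hh.symm
  have sp : ∀ i < k, w (g i) ∈ S := by
    intro i hi
    refine Submodule.subset_span ⟨_, ⟨Or.inr ⟨i, hi, rfl⟩, ?_⟩, rfl⟩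
    intro hh
    have h1 := h.p.inc i hi
    have h2 : y (i + 1) ∈ G.ends (e 0) := by
      rw [show e 0 = g i from (hh : g i = e 0).symm, h1]; simp
    rw [h.c1.inc 0 hn, Sym2.mem_iff] at h2
    rcases h2 with h2 | h2
    · have := h.d1 0 (i + 1) hn (by omega) h2.symm
      omega
    · obtain ⟨j, hj, hj'⟩ := h.c1.mem (0 + 1) (by omega)
      have := h.d1 j (i + 1) hj (by omega) (by rw [← hj', h2])
      omega
  have s1 : ∀ i, 0 < i → i < n → w (e i) ∈ S := by
    intro i hi hin
    refine Submodule.subset_span ⟨_, ⟨Or.inl (Or.inl ⟨i, hin, rfl⟩), ?_⟩, rfl⟩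
    intro hh
    have := h.c1.einj _ _ hin hn hh
    omega
  have a1 := h.c2.neg_span hw h.neg2 S s2
  rw [← h.yk, ← walk_all hw S y g k h.p.inc sp, h.y0] at a1
  have a2 := walk_all hw S (fun i => x (1 + i)) (fun i => e (1 + i)) (n - 1)
    (fun i hi => h.c1.inc _ (by omega)) (fun i hi => s1 _ (by omega) (by omega))
  have hn1 : 1 + (n - 1) = n := by omega
  simp only [hn1, h.c1.close] at a2
  exact hw.mem_of_ends (h.c1.inc 0 hn) S a1 (a2.2 a1)

lemma HC.minus_c1 (hw : G.IsRep w) {n x e nb xb eb k y g} (h : HC G n x e nb xb eb k y g)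
    {i : ℕ} (hi : i < n) :
    LinearIndepOn ℚ w ((e '' Iio n ∪ eb '' Iio nb ∪ g '' Iio k) \ {e i}) := by
  have b0 := ext_neg hw (linearIndepOn_empty ℚ w) h.c2 h.neg2 (by simp)
  have b1 := ext_path hw b0 k _ _ h.p.rev (by
    rintro f (hf | ⟨l, hl, rfl⟩) j hj hjk
    · exact absurd hf (by simp)
    · simp only [mem_Iio] at hl
      refine hw.apply_eq_zero (h.c2.inc l hl) ?_ ?_
      · intro hh
        have := h.d2 _ _ hl (by omega) hh.symm
        omega
      · intro hh
        obtain ⟨l', hl', hl''⟩ := h.c2.mem (l + 1) (by omega)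
        have := h.d2 _ _ hl' (by omega) (hl''.symm.trans hh.symm)
        omega)
  rw [rev_image] at b1
  have b2 := ext_cyc_minus hw b1 h.c1 hi (by
    rintro f ((hf | ⟨l, hl, rfl⟩) | ⟨l, hl, rfl⟩) j hj hjn
    · exact absurd hf (by simp)
    · simp only [mem_Iio] at hl
      refine hw.apply_eq_zero (h.c2.inc l hl) ?_ ?_
      · intro hh
        have := h.d12 _ _ hjn hl hh
        omega
      · intro hh
        obtain ⟨l', hl', hl''⟩ := h.c2.mem (l + 1) (by omega)
        have := h.d12 _ _ hjn hl' (hh.trans hl'')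
        omega
    · simp only [mem_Iio] at hl
      refine hw.apply_eq_zero (h.p.inc l hl) ?_ ?_
      · intro hh
        have h1 := h.d1 _ _ hjn (by omega) hh
        subst h1
        rw [h.y0] at hh
        have := h.c1.inj _ _ hjn h.c1.pos hh
        omega
      · intro hh
        have := h.d1 _ _ hjn (by omega) hh
        omega)
  refine b2.mono ?_
  rintro f ⟨(hf | hf) | hf, hf'⟩
  · exact Or.inr ⟨hf, hf'⟩
  · exact Or.inl (Or.inl (Or.inr hf))
  · exact Or.inl (Or.inr hf)

lemma HC.minus_p (hw : G.IsRep w) {n x e nb xb eb k y g} (h : HC G n x e nb xb eb k y g)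
    {l : ℕ} (hl : l < k) :
    LinearIndepOn ℚ w ((e '' Iio n ∪ eb '' Iio nb ∪ g '' Iio k) \ {g l}) := by
  have b0 := ext_neg hw (linearIndepOn_empty ℚ w) h.c2 h.neg2 (by simp)
  have b1 := ext_neg hw b0 h.c1 h.neg1 (by
    rintro f (hf | ⟨a, ha, rfl⟩) j hj
    · exact absurd hf (by simp)
    · simp only [mem_Iio] at ha
      refine hw.apply_eq_zero (h.c2.inc a ha) ?_ ?_
      · intro hh
        have := h.d12 _ _ hj ha hh
        omega
      · intro hh
        obtain ⟨l', hl', hl''⟩ := h.c2.mem (a + 1) (by omega)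
        have := h.d12 _ _ hj hl' (hh.trans hl'')
        omega)
  have hv : ∀ f ∈ (∅ ∪ eb '' Iio nb) ∪ e '' Iio n, ∀ t, 0 < t → t < k → w f (y t) = 0 := by
    rintro f ((hf | ⟨a, ha, rfl⟩) | ⟨a, ha, rfl⟩) t ht htk
    · exact absurd hf (by simp)
    · simp only [mem_Iio] at ha
      refine hw.apply_eq_zero (h.c2.inc a ha) ?_ ?_
      · intro hh
        have := h.d2 _ _ ha (by omega) hh.symm
        omega
      · intro hh
        obtain ⟨l', hl', hl''⟩ := h.c2.mem (a + 1) (by omega)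
        have := h.d2 _ _ hl' (by omega) (hl''.symm.trans hh.symm)
        omega
    · simp only [mem_Iio] at ha
      refine hw.apply_eq_zero (h.c1.inc a ha) ?_ ?_
      · intro hh
        have := h.d1 _ _ ha (by omega) hh.symm
        omega
      · intro hh
        obtain ⟨l', hl', hl''⟩ := h.c1.mem (a + 1) (by omega)
        have := h.d1 _ _ hl' (by omega) (hl''.symm.trans hh.symm)
        omega
  have q1 : NPath G l y g := by
    have := h.p.sub 0 l (by omega)
    simpa using this
  have b2 := ext_path hw b1 l y g q1 (fun f hf j hj hjl => hv f hf j (by omega) (by omega))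
  have b3 := ext_path hw b2 (k - (l + 1)) _ _ (h.p.sub (l + 1) (k - (l + 1)) (by omega)).rev (by
    rintro f (hf | ⟨a, ha, rfl⟩) j hj hjk
    · exact hv f hf _ (by omega) (by omega)
    · simp only [mem_Iio] at ha
      refine hw.apply_eq_zero (h.p.inc a (by omega)) ?_ ?_
      · intro hh
        have := h.p.inj _ _ (by omega) (by omega) hh
        omega
      · intro hh
        have := h.p.inj _ _ (by omega) (by omega) hh
        omega)
  refine b3.mono ?_
  rintro f ⟨(hf | hf) | ⟨a, ha, rfl⟩, hf'⟩
  · exact Or.inl (Or.inl (Or.inr hf))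
  · exact Or.inl (Or.inl (Or.inl (Or.inr hf)))
  · simp only [mem_Iio] at ha
    rcases lt_trichotomy a l with h3 | h3 | h3
    · left; right; exact ⟨a, h3, rfl⟩
    · subst h3; exact absurd rfl hf'
    · right
      rw [rev_image (fun j => g (l + 1 + j))]
      exact ⟨a - (l + 1), by simp; omega, by show g _ = _; congr 1; omega⟩

lemma FrameCircuit.toN {C : Set E} (h : G.FrameCircuit C) :
    (∃ n x e, NCyc G n x e ∧ G.sp e n = 1 ∧ C = e '' Iio n) ∨
    ∃ n x e nb xb eb k y g, HC G n x e nb xb eb k y g ∧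
      C = e '' Iio n ∪ eb '' Iio nb ∪ g '' Iio k := by
  cases h with
  | pos C h =>
    left
    obtain ⟨x, e, h1, h2, h3, h4, h5⟩ := C.toN (z := C.vtx 0) ⟨0, rfl⟩
    exact ⟨_, x, e, h1, h5.1 h, h3.symm⟩
  | tight C₁ C₂ h₁ h₂ hne v hmeet =>
    right
    have hv : v ∈ C₁.vertices ∩ C₂.vertices := by rw [hmeet]; rfl
    obtain ⟨x, e, a1, a2, a3, a4, a5⟩ := C₁.toN hv.1
    obtain ⟨xb, eb, b1, b2, b3, b4, b5⟩ := C₂.toN hv.2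
    have key : ∀ i j, i < C₁.n → j < C₂.n → x i = xb j → i = 0 ∧ j = 0 := by
      intro i j hi hj hij
      have : x i ∈ C₁.vertices ∩ C₂.vertices :=
        ⟨by rw [← a4]; exact ⟨i, hi, rfl⟩, by rw [hij, ← b4]; exact ⟨j, hj, rfl⟩⟩
      rw [hmeet] at this
      have hxv : x i = v := this
      exact ⟨a1.inj _ _ hi a1.pos (by rw [hxv, a2]),
        b1.inj _ _ hj b1.pos (by rw [← hij, hxv, b2])⟩
    refine ⟨C₁.n, x, e, C₂.n, xb, eb, 0, fun _ => v, e, ?_, ?_⟩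
    · refine ⟨a1, b1, ⟨fun i j hi hj _ => by omega, fun i hi => by omega⟩, fun h => h₁ (a5.2 h),
        fun h => h₂ (b5.2 h), a2.symm, b2.symm, fun i j _ hj _ => by omega,
        fun i j _ hj _ => by omega, fun i j hi hj hij => ?_, ?_⟩
      · have := key i j hi hj hij; tauto
      · intro i j hi hj hij
        have c1 := a1.inc i hi
        have c2 := b1.inc j hj
        rw [hij] at c1
        obtain ⟨i', hi', hi2⟩ := a1.mem (i + 1) (by omega)
        obtain ⟨j', hj', hj2⟩ := b1.mem (j + 1) (by omega)
        rw [c1, hi2, hj2, Sym2.eq_iff] at c2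
        have c3 : i = 0 ∧ i' = 0 ∧ j = 0 ∧ j' = 0 := by
          rcases c2 with c2 | c2
          · have := key _ _ hi hj c2.1
            have := key _ _ hi' hj' c2.2
            tauto
          · have := key _ _ hi hj' c2.1
            have := key _ _ hi' hj c2.2
            tauto
        obtain ⟨rfl, rfl, rfl, rfl⟩ := c3
        have n1 : C₁.n = 1 := by
          by_contra hn
          have := a1.inj _ _ (show 0 + 1 < C₁.n by omega) a1.pos hi2
          omega
        have n2 : C₂.n = 1 := by
          by_contra hn
          have := b1.inj _ _ (show 0 + 1 < C₂.n by omega) b1.pos hj2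
          omega
        apply hne
        rw [← a3, ← b3, n1, n2]
        have : Iio 1 = ({0} : Set ℕ) := by ext; simp
        rw [this, image_singleton, image_singleton, hij]
    · rw [a3, b3]; simp
  | loose C₁ C₂ h₁ h₂ hV P =>
    right
    obtain ⟨y, g, p1, p2, p3, p4, p5⟩ := P.toN (C₁.edge 0)
    obtain ⟨x, e, a1, a2, a3, a4, a5⟩ := C₁.toN p2
    obtain ⟨xb, eb, b1, b2, b3, b4, b5⟩ := C₂.toN p3
    have v1 : ∀ i, i < C₁.n → x i ∈ C₁.vertices := fun i hi => by
      rw [← a4]; exact ⟨i, hi, rfl⟩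
    have v2 : ∀ i, i < C₂.n → xb i ∈ C₂.vertices := fun i hi => by
      rw [← b4]; exact ⟨i, hi, rfl⟩
    have hd : ∀ z, z ∈ C₁.vertices → z ∈ C₂.vertices → False := fun z h1 h2 =>
      Set.disjoint_left.1 hV h1 h2
    refine ⟨C₁.n, x, e, C₂.n, xb, eb, P.n, y, g, ⟨a1, b1, p1, fun h => h₁ (a5.2 h),
        fun h => h₂ (b5.2 h), a2.symm, b2.symm, ?_, ?_, ?_, ?_⟩, ?_⟩
    · intro i j hi hj hij
      by_contra h0
      rcases Nat.lt_or_ge j P.n with h1 | h1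
      · exact p4 j (by omega) h1 (Or.inl (by rw [← hij]; exact v1 i hi))
      · have : j = P.n := by omega
        subst this
        exact hd _ (v1 i hi) (by rw [hij]; exact p3)
    · intro i j hi hj hij
      by_contra h0
      rcases Nat.eq_zero_or_pos j with h1 | h1
      · subst h1
        exact hd _ p2 (by rw [← hij]; exact v2 i hi)
      · exact p4 j h1 (by omega) (Or.inr (by rw [← hij]; exact v2 i hi))
    · intro i j hi hj hij
      exact (hd _ (v1 i hi) (by rw [hij]; exact v2 j hj)).elim
    · intro i j hi hj hij
      have c1 : x i ∈ G.ends (eb j) := by rw [← hij, a1.inc i hi]; simp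
      rw [b1.inc j hj, Sym2.mem_iff] at c1
      obtain ⟨j', hj', hj2⟩ := b1.mem (j + 1) (by omega)
      rcases c1 with c1 | c1
      · exact hd _ (v1 i hi) (by rw [c1]; exact v2 j hj)
      · exact hd _ (v1 i hi) (by rw [c1, hj2]; exact v2 j' hj')
    · rw [a3, b3, p5]

lemma FrameCircuit.dep (hw : G.IsRep w) {C : Set E} (h : G.FrameCircuit C) :
    ¬ LinearIndepOn ℚ w C := by
  rcases h.toN with ⟨n, x, e, h1, h2, rfl⟩ | ⟨n, x, e, nb, xb, eb, k, y, g, h1, rfl⟩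
  · exact h1.pos_dep hw h2
  · exact h1.dep hw

lemma FrameCircuit.minus (hw : G.IsRep w) {C : Set E} (h : G.FrameCircuit C) {f : E}
    (hf : f ∈ C) : LinearIndepOn ℚ w (C \ {f}) := by
  rcases h.toN with ⟨n, x, e, h1, h2, rfl⟩ | ⟨n, x, e, nb, xb, eb, k, y, g, h1, rfl⟩
  · obtain ⟨i, hi, rfl⟩ := hf
    have := ext_cyc_minus hw (linearIndepOn_empty ℚ w) h1 hi (by simp)
    simpa using this
  · rcases hf with (⟨i, hi, rfl⟩ | ⟨i, hi, rfl⟩) | ⟨i, hi, rfl⟩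
    · exact h1.minus_c1 hw hi
    · have := h1.symm.minus_c1 hw hi
      rw [rev_image, union_comm (eb '' _)] at this
      exact this
    · exact h1.minus_p hw hi

end Conv

section Find

variable {G : SGraph V E}

lemma NPath.concat {m k p f q g} (hp : NPath G m p f) (hq : NPath G k q g) (hm : 0 < m)
    (h1 : p m = q 0) (h2 : q k = p 0)
    (hx : ∀ i j, i ≤ m → j ≤ k → p i = q j → (i = m ∧ j = 0) ∨ (i = 0 ∧ j = k))
    (he : ∀ i j, i < m → j < k → f i ≠ g j) :
    ∃ X F, NCyc G (m + k) X F ∧ F '' Iio (m + k) ⊆ f '' Iio m ∪ g '' Iio k ∧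
      G.sp F (m + k) = G.sp f m * G.sp g k := by
  have hF1 : ∀ i, i < m → (fun i => if i < m then f i else g (i - m)) i = f i := by
    intro i hi; simp [hi]
  have hF2 : ∀ i, (fun i => if i < m then f i else g (i - m)) (m + i) = g i := by
    intro i; simp
  have hX1 : ∀ i, i ≤ m → (fun i => if i < m then p i else q (i - m)) i = p i := by
    intro i hi
    rcases Nat.lt_or_ge i m with h | h
    · simp [h]
    · have : i = m := by omega
      subst this; simp [h1]
  have hX2 : ∀ i, (fun i => if i < m then p i else q (i - m)) (m + i) = q i := by
    intro i; simp
  revert hF1 hF2 hX1 hX2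
  generalize (fun i => if i < m then f i else g (i - m)) = F
  generalize (fun i => if i < m then p i else q (i - m)) = X
  intro hF1 hF2 hX1 hX2
  have split : ∀ i, i < m ∨ ∃ j, i = m + j := by
    intro i
    rcases Nat.lt_or_ge i m with h | h
    · exact Or.inl h
    · exact Or.inr ⟨i - m, by omega⟩
  refine ⟨X, F, ⟨by omega, ?_, ?_, ?_, ?_⟩, ?_, ?_⟩
  · intro i j hi hj hij
    rcases split i with h | ⟨i, rfl⟩ <;> rcases split j with h' | ⟨j, rfl⟩
    · rw [hX1 i h.le, hX1 j h'.le] at hij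
      exact hp.inj _ _ h.le h'.le hij
    · rw [hX1 i h.le, hX2] at hij
      have := hx _ _ h.le (by omega) hij
      omega
    · rw [hX1 j h'.le, hX2] at hij
      have := hx _ _ h'.le (by omega) hij.symm
      omega
    · rw [hX2, hX2] at hij
      have := hq.inj _ _ (by omega) (by omega) hij
      omega
  · intro i j hi hj hij
    rcases split i with h | ⟨i, rfl⟩ <;> rcases split j with h' | ⟨j, rfl⟩
    · rw [hF1 i h, hF1 j h'] at hij
      exact hp.einj _ _ h h' hij
    · rw [hF1 i h, hF2] at hij
      exact (he _ _ h (by omega) hij).elim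
    · rw [hF1 j h', hF2] at hij
      exact (he _ _ h' (by omega) hij.symm).elim
    · rw [hF2, hF2] at hij
      have := hq.einj _ _ (by omega) (by omega) hij
      omega
  · intro i hi
    rcases split i with h | ⟨i, rfl⟩
    · rw [hF1 i h, hX1 i h.le, hX1 (i + 1) h, hp.inc i h]
    · rw [hF2, hX2, add_assoc, hX2, hq.inc i (by omega)]
  · rw [hX2, hX1 0 (by omega), h2]
  · rintro _ ⟨i, hi, rfl⟩
    simp only [mem_Iio] at hi
    rcases split i with h | ⟨i, rfl⟩
    · left; exact ⟨i, h, (hF1 i h).symm⟩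
    · right; exact ⟨i, by simp; omega, (hF2 i).symm⟩
  · rw [sp_add, G.sp_congr (n := m) hF1, G.sp_congr (n := k) (fun i _ => hF2 i)]

/-- Walks until hitting `W` or itself. -/
structure Lolli (G : SGraph V E) (T : Set E) (W : Set V) (n : ℕ) (x : ℕ → V) (e : ℕ → E) :
    Prop where
  x0 : x 0 ∈ W
  inj : ∀ i j, i ≤ n → j ≤ n → x i = x j → i = j
  einj : ∀ i j, i ≤ n → j ≤ n → e i = e j → i = j
  mem : ∀ i, i ≤ n → e i ∈ T
  inc : ∀ i, i ≤ n → G.ends (e i) = s(x i, x (i + 1))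
  out : ∀ i, 1 ≤ i → i ≤ n → x i ∉ W
  fin : x (n + 1) ∈ W ∨ ∃ j, 1 ≤ j ∧ j ≤ n ∧ x (n + 1) = x j

lemma exists_lolli {T : Set E} (hT : T.Finite) {W : Set V} {f0 : E} (hf0 : f0 ∈ T) {w0 : V}
    (hw0 : w0 ∈ W) (hwf : w0 ∈ G.ends f0)
    (hdeg : ∀ z, z ∉ W → ∀ f ∈ T, z ∈ G.ends f → ∃ g ∈ T, g ≠ f ∧ z ∈ G.ends g) :
    ∃ n x e, Lolli G T W n x e := by
  classical
  let St := {p : V × E // p.2 ∈ T ∧ p.1 ∈ G.ends p.2}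
  have hstep : ∀ p : St, ∃ q : St, G.ends p.1.2 = s(p.1.1, q.1.1) ∧
      (q.1.1 ∉ W → q.1.2 ≠ p.1.2) := by
    rintro ⟨⟨a, f⟩, hf, ha⟩
    obtain ⟨b, hb⟩ := ha
    by_cases hW : b ∈ W
    · exact ⟨⟨(b, f), hf, by show b ∈ G.ends f; rw [show G.ends f = s(a, b) from hb]; simp⟩, hb,
        fun h => absurd hW h⟩
    · obtain ⟨g, hg, hgf, hbg⟩ := hdeg b hW f hf
        (by rw [show G.ends f = s(a, b) from hb]; simp)
      exact ⟨⟨(b, g), hg, hbg⟩, hb, fun _ => hgf⟩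
  choose nx hnx1 hnx2 using hstep
  let st : ℕ → St := fun i => nx^[i] ⟨(w0, f0), hf0, hwf⟩
  have hst : ∀ i, st (i + 1) = nx (st i) := fun i => Function.iterate_succ_apply' _ _ _
  let x : ℕ → V := fun i => (st i).1.1
  let e : ℕ → E := fun i => (st i).1.2
  have hx0 : x 0 = w0 := rfl
  have heT : ∀ i, e i ∈ T := fun i => (st i).2.1
  have hinc : ∀ i, G.ends (e i) = s(x i, x (i + 1)) := by
    intro i
    have := hnx1 (st i)
    rw [← hst] at this
    exact this
  have hne : ∀ i, x (i + 1) ∉ W → e (i + 1) ≠ e i := by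
    intro i
    have := hnx2 (st i)
    rw [← hst] at this
    exact this
  clear_value x e
  have hfin : (⋃ f ∈ T, {z | z ∈ G.ends f}).Finite := by
    refine hT.biUnion fun f _ => ?_
    induction h : G.ends f with
    | _ a b =>
      refine (Set.toFinite {a, b}).subset ?_
      intro z hz
      simpa using hz
  have hex : ∃ k, 1 ≤ k ∧ (x k ∈ W ∨ ∃ j, 1 ≤ j ∧ j < k ∧ x k = x j) := by
    obtain ⟨a, b, hab, hh⟩ := hfin.exists_lt_map_eq_of_forall_mem (f := fun i : ℕ => x (i + 1))
      (fun i => by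
        simp only [mem_iUnion]
        exact ⟨e i, heT i, by show _ ∈ G.ends (e i); rw [hinc]; simp⟩)
    exact ⟨b + 1, by omega, Or.inr ⟨a + 1, by omega, by omega, hh.symm⟩⟩
  obtain ⟨N1, N2⟩ := Nat.find_spec hex
  have hmin := fun k (hk : k < Nat.find hex) => Nat.find_min hex hk
  revert N1 N2 hmin
  generalize Nat.find hex = N
  intro N1 N2 hmin
  obtain ⟨n, rfl⟩ : ∃ n, N = n + 1 := ⟨N - 1, by omega⟩
  have hout : ∀ i, 1 ≤ i → i ≤ n → x i ∉ W := fun i h1 h2 h3 => hmin i (by omega) ⟨h1, Or.inl h3⟩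
  have hlt : ∀ i j, i < j → j ≤ n → x i ≠ x j := by
    intro i j hij hj h
    rcases Nat.eq_zero_or_pos i with h0 | h0
    · subst h0
      exact hout j (by omega) hj (by rw [← h, hx0]; exact hw0)
    · exact hmin j (by omega) ⟨by omega, Or.inr ⟨i, h0, hij, h.symm⟩⟩
  have hinj : ∀ i j, i ≤ n → j ≤ n → x i = x j → i = j := by
    intro i j hi hj h
    rcases lt_trichotomy i j with h1 | h1 | h1
    · exact (hlt _ _ h1 hj h).elim
    · exact h1
    · exact (hlt _ _ h1 hi h.symm).elim
  have helt : ∀ i j, i < j → j ≤ n → e i ≠ e j := by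
    intro i j hij hj h
    have h1 := hinc i
    rw [h, hinc j, Sym2.eq_iff] at h1
    rcases h1 with h1 | h1
    · exact hlt i j hij hj h1.1.symm
    · have := hinj _ _ hj (by omega) h1.1
      subst this
      exact hne i (hout _ (by omega) hj) h.symm
  refine ⟨n, x, e, by rw [hx0]; exact hw0, hinj, ?_, fun i _ => heT i, fun i _ => hinc i, hout, ?_⟩
  · intro i j hi hj h
    rcases lt_trichotomy i j with h1 | h1 | h1
    · exact (helt _ _ h1 hj h).elim
    · exact h1
    · exact (helt _ _ h1 hi h.symm).elim
  · rcases N2 with h | ⟨j, h1, h2, h3⟩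
    · exact Or.inl h
    · exact Or.inr ⟨j, h1, by omega, h3⟩

lemma Lolli.cyc {T W n x e} (h : Lolli G T W n x e) {j : ℕ} (hj : j ≤ n) (hx : x (n + 1) = x j) :
    NCyc G (n + 1 - j) (fun i => x (j + i)) (fun i => e (j + i)) where
  pos := by omega
  inj i i' h1 h2 h3 := by
    have := h.inj _ _ (by omega) (by omega) h3
    omega
  einj i i' h1 h2 h3 := by
    have := h.einj _ _ (by omega) (by omega) h3
    omega
  inc i hi := h.inc _ (by omega)
  close := by
    have : j + (n + 1 - j) = n + 1 := by omega
    simp only [this, hx, add_zero]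

variable {w : E → V →₀ ℚ}

lemma exists_frame (hw : G.IsRep w) {S : Set E} (hS : ¬ LinearIndepOn ℚ w S) :
    ∃ C ⊆ S, G.FrameCircuit C := by
  classical
  by_contra hno
  push Not at hno
  have noPos : ∀ n x e, NCyc G n x e → e '' Iio n ⊆ S → G.sp e n ≠ 1 := by
    intro n x e h hs h1
    obtain ⟨C, c1, c2, c3⟩ := h.toC
    refine hno _ ?_ (FrameCircuit.pos C (c3.2 h1))
    rw [c1]; exact hs
  rw [linearIndepOn_iff] at hS
  push Not at hS
  obtain ⟨c, hcS, hc0, hcne⟩ := hS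
  have hcS' : ∀ f, c f ≠ 0 → f ∈ S := by
    intro f hf
    exact hcS (by simpa using hf)
  have heval : ∀ z, ∑ f ∈ c.support, c f * w f z = 0 := by
    intro z
    have := DFunLike.congr_fun hc0 z
    rw [Finsupp.linearCombination_apply, Finsupp.sum, Finsupp.finsetSum_apply] at this
    simpa using this
  set T : Set E := {f | c f ≠ 0} with hTdef
  have hTfin : T.Finite := by
    refine c.support.finite_toSet.subset ?_
    intro f hf
    exact Finset.mem_coe.2 (Finsupp.mem_support_iff.2 hf)
  have hTS : T ⊆ S := hcS'
  have deg : ∀ f ∈ T, ∀ z ∈ G.ends f, ∃ g ∈ T, g ≠ f ∧ z ∈ G.ends g := by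
    intro f hf z hz
    by_contra hcon
    push Not at hcon
    have h1 := heval z
    rw [Finset.sum_eq_single f] at h1
    · have h2 : w f z = 0 := (mul_eq_zero.1 h1).resolve_left hf
      obtain ⟨y, hy⟩ := hz
      by_cases hyz : y = z
      · subst hyz
        obtain ⟨ε, hε, h3⟩ := hw _ _ _ hy
        rw [h3] at h2
        rcases G.sg_cases f with h4 | h4
        · refine noPos 1 (fun _ => y) (fun _ => f) ⟨by omega, fun i j _ _ _ => by omega,
            fun i j _ _ _ => by omega, fun i _ => hy, rfl⟩ ?_ ?_
          · rintro _ ⟨i, _, rfl⟩; exact hTS hf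
          · simp [sp, h4]
        · rw [h4] at h2
          simp at h2
          exact hε h2
      · exact hw.apply_ne_zero (x := y) (y := z) (by rw [hy, Sym2.eq_swap]) hyz h2
    · intro g hg hgf
      have hgT : g ∈ T := Finsupp.mem_support_iff.1 hg
      have hz' := hcon g hgT hgf
      induction h : G.ends g with
      | _ a b =>
        rw [h] at hz'
        simp at hz'
        rw [hw.apply_eq_zero h hz'.1 hz'.2, mul_zero]
    · intro h
      exact absurd (by simpa using h) hf
  -- a first cycle
  obtain ⟨f1, hf1⟩ : ∃ f, f ∈ T := by
    by_contra hh
    push Not at hh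
    exact hcne (Finsupp.ext fun f => by simpa [hTdef] using hh f)
  obtain ⟨C, hCT, hCneg⟩ : ∃ C : Cyc G, C.edges ⊆ T ∧ C.Negative := by
    obtain ⟨z, hz⟩ : ∃ z, z ∈ G.ends f1 := by
      induction h : G.ends f1 with
      | _ a b => exact ⟨a, by simp⟩
    obtain ⟨n, x, e, hl⟩ := exists_lolli (W := {z}) hTfin hf1 rfl hz
      (fun z _ f hf hz => deg f hf z hz)
    obtain ⟨j, hj, hxj⟩ : ∃ j, j ≤ n ∧ x (n + 1) = x j := by
      rcases hl.fin with h | ⟨j, _, h1, h2⟩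
      · refine ⟨0, by omega, ?_⟩
        have := hl.x0
        simp only [mem_singleton_iff] at this h
        rw [h, this]
      · exact ⟨j, h1, h2⟩
    have hcy := hl.cyc hj hxj
    obtain ⟨C, c1, c2, c3⟩ := hcy.toC
    have hsub : (fun i => e (j + i)) '' Iio (n + 1 - j) ⊆ T := by
      rintro _ ⟨i, hi, rfl⟩
      simp only [mem_Iio] at hi
      exact hl.mem _ (by omega)
    refine ⟨C, by rw [c1]; exact hsub, fun h => ?_⟩
    exact noPos _ _ _ hcy (hsub.trans hTS) (c3.1 h)
  have hCends : ∀ f ∈ C.edges, ∀ z ∈ G.ends f, z ∈ C.vertices := by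
    rintro _ ⟨i, rfl⟩ z hz
    rw [C.incid, Sym2.mem_iff] at hz
    rcases hz with rfl | rfl <;> exact ⟨_, rfl⟩
  have hCindep : LinearIndepOn ℚ w C.edges := by
    obtain ⟨x, e, a1, a2, a3, a4, a5⟩ := C.toN (z := C.vtx 0) ⟨0, rfl⟩
    have := ext_neg hw (linearIndepOn_empty ℚ w) a1 (fun h => hCneg (a5.2 h)) (by simp)
    simpa [a3] using this
  have hf0 : ∃ f0 ∈ T \ C.edges, ∃ w0 ∈ C.vertices, w0 ∈ G.ends f0 := by
    by_contra hcon
    push Not at hcon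
    have hz0 : ∀ f z, z ∉ G.ends f → w f z = 0 := by
      intro f z hz
      induction h : G.ends f with
      | _ a b =>
        rw [h] at hz
        simp at hz
        exact hw.apply_eq_zero h hz.1 hz.2
    rw [linearIndepOn_iff] at hCindep
    have hcr := hCindep (c.filter (· ∈ C.edges)) (by
      intro f hf
      simp at hf
      exact hf.2) (by
      ext z
      rw [Finsupp.linearCombination_apply, Finsupp.sum, Finsupp.finsetSum_apply,
        Finsupp.support_filter]
      by_cases hzW : z ∈ C.vertices
      · rw [Finset.sum_filter]
        refine Eq.trans (Finset.sum_congr rfl ?_) (heval z)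
        intro f hf
        have hfT : f ∈ T := Finsupp.mem_support_iff.1 hf
        by_cases hfC : f ∈ C.edges
        · simp [hfC]
        · rw [if_neg hfC, hz0 f z (hcon f ⟨hfT, hfC⟩ z hzW), mul_zero]
      · refine Finset.sum_eq_zero fun f hf => ?_
        have hfC : f ∈ C.edges := (Finset.mem_filter.1 hf).2
        have := hz0 f z (fun h => hzW (hCends f hfC z h))
        simp [this])
    have hm : C.edge 0 ∈ C.edges := ⟨0, rfl⟩
    have := DFunLike.congr_fun hcr (C.edge 0)
    rw [Finsupp.filter_apply_pos _ _ hm] at this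
    exact hCT hm this
  obtain ⟨f0, hf0, w0, hw0, hwf0⟩ := hf0
  obtain ⟨n, x, e, hl⟩ := exists_lolli (W := C.vertices) (hTfin.subset sdiff_subset) hf0 hw0 hwf0 (by
    intro z hz f hf hzf
    obtain ⟨g, hg, hgf, hzg⟩ := deg f hf.1 z hzf
    exact ⟨g, ⟨hg, fun h => hz (hCends g h z hzg)⟩, hgf, hzg⟩)
  obtain ⟨y, d, y1, y2, y3, y4, y5⟩ := C.toN hl.x0
  have hdC : ∀ i < C.n, d i ∈ C.edges := fun i hi => by rw [← y3]; exact ⟨i, hi, rfl⟩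
  have hyC : ∀ i < C.n, y i ∈ C.vertices := fun i hi => by rw [← y4]; exact ⟨i, hi, rfl⟩
  rcases hl.fin with hW | ⟨j, hj1, hjn, hxj⟩
  · rw [← y4] at hW
    obtain ⟨m, hm, hxm⟩ := hW
    simp only [mem_Iio] at hm
    rcases Nat.eq_zero_or_pos m with h0 | h0
    · -- tight handcuff
      subst h0
      have hcy := hl.cyc (j := 0) (by omega) (by rw [← hxm, y2])
      have hsub : (fun i => e (0 + i)) '' Iio (n + 1 - 0) ⊆ T \ C.edges := by
        rintro _ ⟨i, hi, rfl⟩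
        simp only [mem_Iio] at hi
        exact hl.mem _ (by omega)
      obtain ⟨C2, c1, c2, c3⟩ := hcy.toC
      refine hno _ ?_ (FrameCircuit.tight C C2 hCneg (fun h => ?_) ?_ (x 0) ?_)
      · rw [c1]
        exact union_subset (hCT.trans hTS) ((hsub.trans sdiff_subset).trans hTS)
      · exact noPos _ _ _ hcy ((hsub.trans sdiff_subset).trans hTS) (c3.1 h)
      · intro h
        have hm : C.edge 0 ∈ C.edges := ⟨0, rfl⟩
        have hm' := hm
        rw [h, c1] at hm'
        exact (hsub hm').2 hm
      · rw [c2]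
        ext z
        simp only [mem_inter_iff, mem_singleton_iff]
        constructor
        · rintro ⟨hz, i, hi, rfl⟩
          simp only [mem_Iio] at hi
          simp only [zero_add] at hz ⊢
          rcases Nat.eq_zero_or_pos i with h1 | h1
          · rw [h1]
          · exact (hl.out i h1 (by omega) hz).elim
        · rintro rfl
          exact ⟨hl.x0, 0, by simp, rfl⟩
    · -- theta
      have hP : NPath G (n + 1) x e := by
        refine ⟨?_, fun i hi => hl.inc i (by omega)⟩
        have key : ∀ i, i ≤ n → x i ≠ x (n + 1) := by
          intro i hi h
          rcases Nat.eq_zero_or_pos i with h1 | h1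
          · subst h1
            rw [← y2, ← hxm] at h
            have := y1.inj _ _ y1.pos hm h
            omega
          · refine hl.out i h1 hi ?_
            rw [h, ← hxm]
            exact hyC m hm
        intro i k hi hk hik
        rcases Nat.lt_or_ge n i with h1 | h1 <;> rcases Nat.lt_or_ge n k with h2 | h2
        · omega
        · have : i = n + 1 := by omega
          subst this
          exact (key k h2 hik.symm).elim
        · have : k = n + 1 := by omega
          subst this
          exact (key i h1 hik).elim
        · exact hl.inj _ _ h1 h2 hik
      have hcross : ∀ i k, i ≤ n + 1 → k < C.n → x i = y k →
          (i = 0 ∧ k = 0) ∨ (i = n + 1 ∧ k = m) := by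
        intro i k hi hk hik
        rcases Nat.eq_zero_or_pos i with h1 | h1
        · left
          subst h1
          rw [← y2] at hik
          exact ⟨rfl, (y1.inj _ _ y1.pos hk hik).symm⟩
        · rcases Nat.lt_or_ge n i with h2 | h2
          · right
            have : i = n + 1 := by omega
            subst this
            rw [← hxm] at hik
            exact ⟨rfl, (y1.inj _ _ hm hk hik).symm⟩
          · exact (hl.out i h1 h2 (by rw [hik]; exact hyC k hk)).elim
      have hed : ∀ i k, i ≤ n → k < C.n → e i ≠ d k := by
        intro i k hi hk h
        exact (hl.mem i hi).2 (by rw [h]; exact hdC k hk)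
      have hsd : ∀ k, k < C.n → d k ∈ S := fun k hk => hTS (hCT (hdC k hk))
      have hse : ∀ i, i ≤ n → e i ∈ S := fun i hi => hTS (hl.mem i hi).1
      obtain ⟨X1, F1, z1, z2, z3⟩ := (y1.front m hm).concat hP.rev h0
        (by simp [hxm]) (by simp [y2]) (by
          intro i k hi hk hik
          have := hcross _ _ (by omega) (by omega) hik.symm
          omega) (by
          intro i k hi hk h
          exact hed _ _ (by omega) (by omega) h.symm)
      obtain ⟨X2, F2, q1, q2, q3⟩ := (y1.tail m h0 hm.le).concat hP (by omega)
        (by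
          have : m + (C.n - m) = C.n := by omega
          simp only [this, y1.close, y2])
        (by simp [hxm]) (by
          intro i k hi hk hik
          rcases Nat.lt_or_ge (m + i) C.n with h1 | h1
          · have := hcross _ _ hk h1 hik.symm
            omega
          · have h2 : m + i = C.n := by omega
            simp only [h2, y1.close] at hik
            have := hcross _ _ hk y1.pos hik.symm
            omega) (by
          intro i k hi hk h
          exact hed _ _ (by omega) (by omega) h.symm)
      have n1 := noPos _ _ _ z1 (by
        refine z2.trans ?_
        rintro f (⟨i, hi, rfl⟩ | ⟨i, hi, rfl⟩)
        · simp only [mem_Iio] at hi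
          exact hsd _ (by omega)
        · exact hse _ (by omega))
      have n2 := noPos _ _ _ q1 (by
        refine q2.trans ?_
        rintro f (⟨i, hi, rfl⟩ | ⟨i, hi, rfl⟩)
        · simp only [mem_Iio] at hi
          exact hsd _ (by omega)
        · simp only [mem_Iio] at hi
          exact hse _ (by omega))
      have n3 : G.sp d C.n ≠ 1 := fun h => hCneg (y5.2 h)
      have hCn : C.n = m + (C.n - m) := by omega
      rw [hCn, sp_add] at n3
      rw [z3, sp_rev] at n1
      rw [q3] at n2
      rcases G.sp_cases d m with a | a <;>
        rcases G.sp_cases (fun i => d (m + i)) (C.n - m) with b | b <;>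
        rcases G.sp_cases e (n + 1) with c | c <;>
        revert n1 n2 n3 <;> rw [a, b, c] <;> norm_num
  · -- loose handcuff
    have hcy := hl.cyc hjn hxj
    have hsub : (fun i => e (j + i)) '' Iio (n + 1 - j) ⊆ T := by
      rintro _ ⟨i, hi, rfl⟩
      simp only [mem_Iio] at hi
      exact (hl.mem _ (by omega)).1
    obtain ⟨C2, c1, c2, c3⟩ := hcy.toC
    have hv2 : ∀ z ∈ C2.vertices, ∃ k, j ≤ k ∧ k ≤ n ∧ z = x k := by
      intro z hz
      rw [c2] at hz
      obtain ⟨i, hi, rfl⟩ := hz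
      simp only [mem_Iio] at hi
      exact ⟨j + i, by omega, by omega, rfl⟩
    have hP : NPath G j x e :=
      ⟨fun i k hi hk h => hl.inj _ _ (by omega) (by omega) h, fun i hi => hl.inc i (by omega)⟩
    obtain ⟨P, hPe⟩ := hP.toP (S := C.vertices) (T := C2.vertices) hl.x0
      (by rw [c2]; exact ⟨0, by simp; omega, rfl⟩) (by
        rintro i hi hij (h | h)
        · exact hl.out i hi (by omega) h
        · obtain ⟨k, k1, k2, k3⟩ := hv2 _ h
          have := hl.inj _ _ (by omega) (by omega) k3
          omega)
    refine hno _ ?_ (FrameCircuit.loose C C2 hCneg (fun h => ?_) ?_ P)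
    · rw [c1, hPe]
      refine union_subset (union_subset (hCT.trans hTS) (hsub.trans hTS)) ?_
      rintro _ ⟨i, hi, rfl⟩
      simp only [mem_Iio] at hi
      exact hTS (hl.mem _ (by omega)).1
    · exact noPos _ _ _ hcy (hsub.trans hTS) (c3.1 h)
    · rw [Set.disjoint_left]
      intro z hz hz2
      obtain ⟨k, k1, k2, rfl⟩ := hv2 _ hz2
      exact hl.out k (by omega) k2 hz

end Find

section Final

variable {G : SGraph V E}

lemma exists_rep (G : SGraph V E) : ∃ w, G.IsRep w := by
  have h : ∀ f, ∃ p : V × V, G.ends f = s(p.1, p.2) := by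
    intro f
    induction h : G.ends f with
    | _ a b => exact ⟨(a, b), rfl⟩
  choose p hp using h
  refine ⟨fun f => Finsupp.single (p f).1 1 - Finsupp.single (p f).2 (G.sg f), ?_⟩
  intro f x y hxy
  rw [hp f, Sym2.eq_iff] at hxy
  rcases hxy with ⟨h1, h2⟩ | ⟨h1, h2⟩
  · exact ⟨1, one_ne_zero, by simp [h1, h2]⟩
  · refine ⟨-G.sg f, neg_ne_zero.2 (G.sg_ne_zero f), ?_⟩
    simp only [h1, h2, smul_sub, Finsupp.smul_single, smul_eq_mul, neg_mul, G.sg_mul_self, mul_one]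
    simp only [Finsupp.single_neg]
    abel

variable {w : E → V →₀ ℚ}

lemma IsFrameMatroid.indep_iff {M : Matroid E} (hM : G.IsFrameMatroid M) (hw : G.IsRep w)
    (I : Set E) : M.Indep I ↔ LinearIndepOn ℚ w I := by
  constructor
  · intro hI
    by_contra hcon
    obtain ⟨C, hC, hf⟩ := exists_frame hw hcon
    exact ((hM.2 C).2 hf).2.1 (hI.subset hC)
  · intro hI
    by_contra hcon
    have hd : M.Dep I := ⟨hcon, by rw [hM.1]; exact subset_univ _⟩
    obtain ⟨C, hC, hc⟩ := hd.exists_isCircuit_subset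
    rw [Matroid.isCircuit_iff_forall_ssubset] at hc
    have : M.IsCircuit' C := ⟨hc.1.2, hc.1.1, fun D hD => hc.2 hD⟩
    exact ((hM.2 C).1 this).dep hw (hI.mono hC)

lemma isFrameMatroid_of {M : Matroid E} (hw : G.IsRep w) (hE : M.E = univ)
    (h : ∀ I, M.Indep I ↔ LinearIndepOn ℚ w I) : G.IsFrameMatroid M := by
  refine ⟨hE, fun C => ⟨?_, ?_⟩⟩
  · rintro ⟨_, h1, h2⟩
    rw [h] at h1
    obtain ⟨D, hD, hf⟩ := exists_frame hw h1
    rcases eq_or_ssubset_of_subset hD with rfl | hlt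
    · exact hf
    · exact (hf.dep hw ((h D).1 (h2 D hlt))).elim
  · intro hC
    refine ⟨by rw [hE]; exact subset_univ _, fun hh => hC.dep hw ((h C).1 hh), ?_⟩
    intro D hD
    obtain ⟨f, hf, hfD⟩ := exists_of_ssubset hD
    rw [h]
    exact (hC.minus hw hf).mono fun g hg => ⟨hD.subset hg, fun hgf => hfD (by
      rw [← show g = f from hgf]; exact hg)⟩

/-- The representation of the contraction. -/
lemma IsRep.contract [DecidableEq V] (hw : G.IsRep w) (e : E) (u v : V) :
    (G.contractEdge e u v).IsRep
      (fun f => Finsupp.lmapDomain ℚ ℚ (fun x => if x = v then u else x) (w f.1)) := by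
  intro f x y hxy
  have hs : (G.contractEdge e u v).sg f = G.sg f.1 := rfl
  rw [hs]
  have key : ∀ a b, G.ends f.1 = s(a, b) → (if a = v then u else a) = x →
      (if b = v then u else b) = y → ∃ ε : ℚ, ε ≠ 0 ∧
        Finsupp.lmapDomain ℚ ℚ (fun x => if x = v then u else x) (w f.1) =
          ε • (Finsupp.single x 1 - Finsupp.single y (G.sg f.1)) := by
    intro a b hab ha hb
    obtain ⟨ε, hε, h⟩ := hw _ _ _ hab
    refine ⟨ε, hε, ?_⟩
    rw [h]
    simp only [map_smul, map_sub, Finsupp.lmapDomain_apply, Finsupp.mapDomain_single, ha, hb]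
  induction h : G.ends f.1 with
  | _ a b =>
    have h1 : (G.contractEdge e u v).ends f =
      (G.ends f.1).map (fun x => if x = v then u else x) := rfl
    rw [h1, h, Sym2.map_mk, Sym2.eq_iff] at hxy
    rcases hxy with hxy | hxy
    · exact key a b h hxy.1 hxy.2
    · exact key b a (by rw [h, Sym2.eq_swap]) hxy.2 hxy.1

lemma contract_indep [DecidableEq V] (hw : G.IsRep w) {e : E} {u v : V} (huv : u ≠ v)
    (hends : G.ends e = s(u, v)) (hpos : e ∉ G.neg) (I : Set {f : E // f ≠ e}) :
    LinearIndepOn ℚ w ({e} ∪ Subtype.val '' I) ↔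
      LinearIndepOn ℚ
        (fun f : {f : E // f ≠ e} =>
          Finsupp.lmapDomain ℚ ℚ (fun x => if x = v then u else x) (w f.1)) I := by
  set π : (V →₀ ℚ) →ₗ[ℚ] (V →₀ ℚ) := Finsupp.lmapDomain ℚ ℚ (fun x => if x = v then u else x)
    with hπ
  have hsg : G.sg e = 1 := by simp [sg, hpos]
  obtain ⟨ε, hε, he⟩ := hw _ _ _ hends
  rw [hsg] at he
  have hne : w e ≠ 0 := by
    intro h
    exact hw.apply_ne_zero hends huv (by rw [h]; rfl)
  have hdisj : Disjoint ({e} : Set E) (Subtype.val '' I) := by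
    rw [Set.disjoint_left]
    rintro _ rfl ⟨f, _, hf⟩
    exact f.2 hf
  have h1 : LinearIndepOn ℚ w {e} := by
    rw [linearIndepOn_singleton_iff]; exact hne
  rw [linearIndepOn_union_iff_quotient hdisj, and_iff_right h1, image_singleton]
  have hπe : π (w e) = 0 := by
    rw [he, hπ]
    simp only [map_smul, map_sub, Finsupp.lmapDomain_apply, Finsupp.mapDomain_single]
    simp
  have hle : Submodule.span ℚ {w e} ≤ LinearMap.ker π := by
    rw [Submodule.span_le]
    rintro _ rfl
    exact hπe
  have hdiff : ∀ z : V →₀ ℚ, π z - z ∈ Submodule.span ℚ {w e} := by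
    intro z
    induction z using Finsupp.induction_linear with
    | zero => simp
    | add f g hf hg =>
      have := Submodule.add_mem _ hf hg
      rw [map_add]
      convert this using 1
      abel
    | single a r =>
      rw [hπ, Finsupp.lmapDomain_apply, Finsupp.mapDomain_single]
      by_cases ha : a = v
      · subst ha
        rw [Submodule.mem_span_singleton]
        refine ⟨r * ε⁻¹, ?_⟩
        rw [he, smul_smul, mul_assoc, inv_mul_cancel₀ hε]
        simp [smul_sub]
      · simp [ha]
  have hker : LinearMap.ker π ≤ Submodule.span ℚ {w e} := by
    intro z hz
    have := hdiff z
    rw [LinearMap.mem_ker.1 hz, zero_sub] at this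
    exact (Submodule.neg_mem_iff _).1 this
  have hinj : Function.Injective ((Submodule.span ℚ {w e}).liftQ π hle) := by
    rw [← LinearMap.ker_eq_bot]
    exact Submodule.ker_liftQ_eq_bot _ _ _ hker
  have h2 : LinearIndepOn ℚ ((Submodule.span ℚ {w e}).mkQ ∘ w) (Subtype.val '' I) ↔
      LinearIndepOn ℚ (((Submodule.span ℚ {w e}).mkQ ∘ w) ∘ Subtype.val) I :=
    ⟨fun h => h.comp_of_image Subtype.val_injective.injOn, fun h => h.image_of_comp _ _⟩
  rw [h2, ← LinearMap.linearIndepOn_iff_of_injOn ((Submodule.span ℚ {w e}).liftQ π hle)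
    hinj.injOn]
  rfl

end Final
end SGraph

/-- contracting a positive non-loop edge commutes with the frame
matroid construction: `M(Ω/e) = M(Ω)/e`. -/
theorem frameMatroid_contract
    {V E : Type*} [DecidableEq V] (G : SGraph V E) (e : E) (u v : V)
    (huv : u ≠ v) (hends : G.ends e = s(u, v)) (hpos : e ∉ G.neg)
    (M : Matroid E) (hM : G.IsFrameMatroid M) :
    (G.contractEdge e u v).IsFrameMatroid ((M.con {e}).comap Subtype.val) := by
  obtain ⟨w, hw⟩ := G.exists_rep
  have hI := hM.indep_iff hw
  have hcon : M.con {e} = M.contract {e} := rfl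
  have hne : w e ≠ 0 := by
    intro h
    exact hw.apply_ne_zero hends huv (by rw [h]; rfl)
  have he : M.Indep {e} := by
    rw [hI, linearIndepOn_singleton_iff]; exact hne
  refine SGraph.isFrameMatroid_of (hw.contract e u v) ?_ ?_
  · rw [Matroid.comap_ground_eq, hcon, Matroid.contract_ground, hM.1]
    ext f
    simpa using f.2
  · intro I
    rw [Matroid.comap_indep_iff, hcon, he.contract_indep_iff, hI,
      ← SGraph.contract_indep hw huv hends hpos, union_comm]
    constructor
    · exact fun h => h.1.2
    · intro h
      refine ⟨⟨?_, h⟩, Subtype.val_injective.injOn⟩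
      rw [Set.disjoint_left]
      rintro _ ⟨f, _, rfl⟩ hf
      exact f.2 hf
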